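/- arXiv:1602.00233 — 3 statements merged into one kernel-verified Lean document; each statement's English description precedes it below -/
import Mathlib

section
/- Operator Efron–Stein inequality: Let X₁,…,Xₙ be independent random variables and let Z = f(X₁,…,Xₙ) be a d×d positive semidefinite random matrix such that Z and Z² are Bochner integrable. Let X₁′,…,Xₙ′ be independent copies of X₁,…,Xₙ, and for each i set Z⁽ⁱ⁾ = f(X₁,…,X_{i−1}, Xᵢ′, X_{i+1},…,Xₙ). Then E[Z²] − (E[Z])² ⪯ (1/2)·Σ_{i=1}^n E[(Z − Z⁽ⁱ⁾)²] in the Löwner order. -/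
open MeasureTheory
open scoped ComplexOrder

noncomputable section

/-- The space of `d × d` complex matrices. -/
abbrev Mat (d : ℕ) := Matrix (Fin d) (Fin d) ℂ

/-- Löwner partial order: `A ⪯ B` iff `B - A` is positive semidefinite. -/
def LoewnerLE {d : ℕ} (A B : Mat d) : Prop := (B - A).PosSemidef

/-- Entrywise Bochner expectation of a matrix-valued random variable. -/
def expMat {Ω : Type*} [MeasurableSpace Ω] (μ : Measure Ω) {d : ℕ}
    (Z : Ω → Mat d) : Mat d := Matrix.of fun i j => ∫ ω, Z ω i j ∂μ

/-- Entrywise Bochner integrability of a matrix-valued random variable. -/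
def MatIntegrable {Ω : Type*} [MeasurableSpace Ω] (μ : Measure Ω) {d : ℕ}
    (Z : Ω → Mat d) : Prop := ∀ i j, Integrable (fun ω => Z ω i j) μ

section EfronStein

open Set
open scoped symmDiff RealInnerProductSpace

variable {ι : Type*} {Ω : ι → Type*}

open Classical in
/-- Exchange the coordinates indexed by `S` between the two components of a pair. -/
def swapOn (S : Set ι) (p : (∀ i, Ω i) × (∀ i, Ω i)) : (∀ i, Ω i) × (∀ i, Ω i) :=
  (fun i => if i ∈ S then p.2 i else p.1 i, fun i => if i ∈ S then p.1 i else p.2 i)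

lemma swapOn_swapOn (S R : Set ι) (p : (∀ i, Ω i) × (∀ i, Ω i)) :
    swapOn S (swapOn R p) = swapOn (S ∆ R) p := by
  ext i <;> by_cases hS : i ∈ S <;> by_cases hR : i ∈ R <;>
    simp [swapOn, Set.mem_symmDiff, hS, hR]

lemma swapOn_empty (p : (∀ i, Ω i) × (∀ i, Ω i)) : swapOn ∅ p = p := by
  simp [swapOn]

lemma swapOn_univ (p : (∀ i, Ω i) × (∀ i, Ω i)) : swapOn univ p = p.swap := by
  ext <;> simp [swapOn]

lemma swapOn_singleton_fst [DecidableEq ι] (i : ι) (p : (∀ i, Ω i) × (∀ i, Ω i)) :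
    (swapOn {i} p).1 = Function.update p.1 i (p.2 i) := by
  ext j
  by_cases h : j = i
  · subst h; simp [swapOn]
  · simp [swapOn, h]

variable [Fintype ι] [∀ i, MeasurableSpace (Ω i)] (μ : ∀ i, Measure (Ω i))
  [∀ i, IsProbabilityMeasure (μ i)]

/-- Pairs of dependent functions are dependent functions into pairs. -/
def piProdEquiv (Ω : ι → Type*) [∀ i, MeasurableSpace (Ω i)] :
    (∀ i, Ω i × Ω i) ≃ᵐ (∀ i, Ω i) × (∀ i, Ω i) where
  toFun w := (fun i => (w i).1, fun i => (w i).2)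
  invFun p i := (p.1 i, p.2 i)
  left_inv _ := rfl
  right_inv _ := rfl
  measurable_toFun := by dsimp; fun_prop
  measurable_invFun := by dsimp; fun_prop

lemma measurePreserving_piProdEquiv :
    MeasurePreserving (piProdEquiv Ω) (Measure.pi fun i => (μ i).prod (μ i))
      ((Measure.pi μ).prod (Measure.pi μ)) := by
  refine ⟨(piProdEquiv Ω).measurable,
    (Measure.FiniteSpanningSetsIn.ext ?_ (isPiSystem_pi.prod isPiSystem_pi)
    ((Measure.FiniteSpanningSetsIn.pi fun i => (μ i).toFiniteSpanningSetsIn).prod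
    (Measure.FiniteSpanningSetsIn.pi fun i => (μ i).toFiniteSpanningSetsIn)) ?_).symm⟩
  · have hspan := (Measure.FiniteSpanningSetsIn.pi
      fun i => (μ i).toFiniteSpanningSetsIn).isCountablySpanning
    exact (generateFrom_eq_prod generateFrom_pi generateFrom_pi hspan hspan).symm
  · rintro _ ⟨s, ⟨s, _, rfl⟩, ⟨_, ⟨t, _, rfl⟩, rfl⟩⟩
    have h : piProdEquiv Ω ⁻¹' (univ.pi s ×ˢ univ.pi t) = univ.pi fun i => s i ×ˢ t i := by
      ext
      simp [piProdEquiv, Set.mem_pi, forall_and]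
    rw [MeasurableEquiv.map_apply, h]
    simp_rw [Measure.prod_prod, Measure.pi_pi, Measure.prod_prod, ← Finset.prod_mul_distrib]

lemma measurePreserving_swapOn (S : Set ι) :
    MeasurePreserving (swapOn S) ((Measure.pi μ).prod (Measure.pi μ))
      ((Measure.pi μ).prod (Measure.pi μ)) := by
  classical
  have he := measurePreserving_piProdEquiv μ
  have hs := measurePreserving_pi (fun i => (μ i).prod (μ i)) (fun i => (μ i).prod (μ i))
    (f := fun i => if i ∈ S then Prod.swap else id) fun i => by
      split_ifs
      · exact Measure.measurePreserving_swap
      · exact MeasurePreserving.id _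
  convert! he.comp (hs.comp (he.symm _)) using 1
  funext p
  ext i <;> by_cases h : i ∈ S <;> simp [swapOn, piProdEquiv, h]

variable {E : Type*} [NormedAddCommGroup E] [InnerProductSpace ℝ E]

lemma integrable_inner_of_memLp {α : Type*} [MeasurableSpace α] {ν : Measure α} {g h : α → E}
    (hg : MemLp g 2 ν) (hh : MemLp h 2 ν) : Integrable (fun x => ⟪g x, h x⟫) ν := by
  refine (hg.norm.integrable_mul hh.norm).mono' (hg.1.inner hh.1) (ae_of_all _ fun x => ?_)
  exact norm_inner_le_norm _ _

variable {μ} {h : (∀ i, Ω i) → E}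

lemma memLp_swapOn {F : Type*} [NormedAddCommGroup F] {h : (∀ i, Ω i) → F}
    (hh : MemLp h 2 (Measure.pi μ)) (S : Set ι) :
    MemLp (fun p => h (swapOn S p).1) 2 ((Measure.pi μ).prod (Measure.pi μ)) :=
  (hh.comp_measurePreserving measurePreserving_fst).comp_measurePreserving
    (measurePreserving_swapOn μ S)

lemma integral_comp_swapOn {F : Type*} [NormedAddCommGroup F] [NormedSpace ℝ F] (S : Set ι)
    (g : (∀ i, Ω i) × (∀ i, Ω i) → F) :
    ∫ p, g (swapOn S p) ∂((Measure.pi μ).prod (Measure.pi μ)) =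
      ∫ p, g p ∂((Measure.pi μ).prod (Measure.pi μ)) := by
  have hinv : Function.Involutive (swapOn (Ω := Ω) S) := fun p => by
    rw [swapOn_swapOn, symmDiff_self, Set.bot_eq_empty, swapOn_empty]
  have hm := measurePreserving_swapOn μ S
  exact hm.integral_comp' (f := ⟨hinv.toPerm, hm.measurable, hm.measurable⟩) g

lemma integral_inner_swapOn_sub_le (hh : MemLp h 2 (Measure.pi μ)) {S : Set ι} {i : ι}
    (hi : i ∉ S) :
    ∫ p, ⟪h p.1, h (swapOn S p).1⟫ ∂((Measure.pi μ).prod (Measure.pi μ)) -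
        ∫ p, ⟪h p.1, h (swapOn (insert i S) p).1⟫ ∂((Measure.pi μ).prod (Measure.pi μ)) ≤
      1 / 2 * ∫ p, ‖h p.1 - h (swapOn {i} p).1‖ ^ 2
        ∂((Measure.pi μ).prod (Measure.pi μ)) := by
  set Q := (Measure.pi μ).prod (Measure.pi μ)
  have e1 : S ∆ {i} = insert i S := by
    ext j; by_cases hj : j = i <;> simp_all [Set.mem_symmDiff]
  have e2 : insert i S ∆ {i} = S := by rw [← e1, symmDiff_symmDiff_cancel_right]
  have e3 : {i} ∆ S = insert i S := by rw [symmDiff_comm, e1]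
  have m0 : MemLp (fun p => h p.1) 2 Q := hh.comp_measurePreserving measurePreserving_fst
  have mi : MemLp _ 2 Q := memLp_swapOn hh {i}
  have mS : MemLp _ 2 Q := memLp_swapOn hh S
  have mT : MemLp _ 2 Q := memLp_swapOn hh (insert i S)
  have hQ : ∀ (R : Set ι) (g : (∀ i, Ω i) × (∀ i, Ω i) → ℝ),
    ∫ p, g (swapOn R p) ∂Q = ∫ p, g p ∂Q := integral_comp_swapOn
  have h1 : ∫ p, ⟪h p.1, h (swapOn S p).1⟫ ∂Q =
      ∫ p, ⟪h (swapOn {i} p).1, h (swapOn (insert i S) p).1⟫ ∂Q := by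
    rw [← hQ {i}]
    simp_rw [swapOn_swapOn, e1]
  have h2 : ∫ p, ⟪h p.1, h (swapOn (insert i S) p).1⟫ ∂Q =
      ∫ p, ⟪h (swapOn {i} p).1, h (swapOn S p).1⟫ ∂Q := by
    rw [← hQ {i}]
    simp_rw [swapOn_swapOn, e2]
  have h3 : ∫ p, ‖h p.1 - h (swapOn {i} p).1‖ ^ 2 ∂Q =
      ∫ p, ‖h (swapOn S p).1 - h (swapOn (insert i S) p).1‖ ^ 2 ∂Q := by
    rw [← hQ S]
    simp_rw [swapOn_swapOn, e3]
  have n1 : Integrable (fun p => ‖h p.1 - h (swapOn {i} p).1‖ ^ 2) Q :=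
    (m0.sub mi).norm.integrable_sq
  have n2 : Integrable (fun p => ‖h (swapOn S p).1 - h (swapOn (insert i S) p).1‖ ^ 2) Q :=
    (mS.sub mT).norm.integrable_sq
  have key : ∫ p, ⟪h p.1, h (swapOn S p).1⟫ ∂Q - ∫ p, ⟪h p.1, h (swapOn (insert i S) p).1⟫ ∂Q +
      (∫ p, ⟪h (swapOn {i} p).1, h (swapOn (insert i S) p).1⟫ ∂Q -
        ∫ p, ⟪h (swapOn {i} p).1, h (swapOn S p).1⟫ ∂Q) ≤
      1 / 2 * ∫ p, ‖h p.1 - h (swapOn {i} p).1‖ ^ 2 ∂Q +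
        1 / 2 * ∫ p, ‖h (swapOn S p).1 - h (swapOn (insert i S) p).1‖ ^ 2 ∂Q := by
    have i1 := integrable_inner_of_memLp m0 mS
    have i2 := integrable_inner_of_memLp m0 mT
    have i3 := integrable_inner_of_memLp mi mT
    have i4 := integrable_inner_of_memLp mi mS
    rw [← integral_sub' i1 i2, ← integral_sub' i3 i4, ← integral_add' (i1.sub i2) (i3.sub i4),
      ← integral_const_mul, ← integral_const_mul,
      ← integral_add (n1.const_mul _) (n2.const_mul _)]
    refine integral_mono ((i1.sub i2).add (i3.sub i4))
      ((n1.const_mul _).add (n2.const_mul _)) fun p => ?_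
    have a := real_inner_le_norm (h p.1 - h (swapOn {i} p).1)
      (h (swapOn S p).1 - h (swapOn (insert i S) p).1)
    have b := two_mul_le_add_sq ‖h p.1 - h (swapOn {i} p).1‖
      ‖h (swapOn S p).1 - h (swapOn (insert i S) p).1‖
    simp only [inner_sub_left, inner_sub_right] at a
    simp only [Pi.add_apply, Pi.sub_apply]
    linarith
  linarith

/-- The Efron–Stein inequality for square-integrable functions into a Hilbert space. -/
theorem efron_stein [CompleteSpace E] {n : ℕ} {Ω : Fin n → Type*} [∀ i, MeasurableSpace (Ω i)]
    {μ : ∀ i, Measure (Ω i)} [∀ i, IsProbabilityMeasure (μ i)] {h : (∀ i, Ω i) → E}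
    (hh : MemLp h 2 (Measure.pi μ)) :
    ∫ x, ‖h x‖ ^ 2 ∂(Measure.pi μ) - ‖∫ x, h x ∂(Measure.pi μ)‖ ^ 2 ≤
      1 / 2 * ∑ i, ∫ p, ‖h p.1 - h (Function.update p.1 i (p.2 i))‖ ^ 2
        ∂((Measure.pi μ).prod (Measure.pi μ)) := by
  set P := Measure.pi μ
  set c : ℕ → ℝ := fun k => ∫ p, ⟪h p.1, h (swapOn {j : Fin n | j.val < k} p).1⟫ ∂(P.prod P)
    with hc
  have c0 : c 0 = ∫ x, ‖h x‖ ^ 2 ∂P := by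
    simp only [hc, not_lt_zero, ofPred_false, swapOn_empty, real_inner_self_eq_norm_sq]
    rw [integral_fun_fst (fun x => ‖h x‖ ^ 2)]
    simp [P]
  have cn : c n = ‖∫ x, h x ∂P‖ ^ 2 := by
    have m1 : MemLp (fun p : (∀ i, Ω i) × (∀ i, Ω i) => h p.1) 2 (P.prod P) :=
      hh.comp_measurePreserving measurePreserving_fst
    have m2 : MemLp (fun p : (∀ i, Ω i) × (∀ i, Ω i) => h p.2) 2 (P.prod P) :=
      hh.comp_measurePreserving measurePreserving_snd
    have hI : Integrable h P := hh.integrable (by norm_num)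
    simp only [hc, Fin.is_lt, ofPred_true, swapOn_univ, Prod.fst_swap]
    rw [integral_prod _ (integrable_inner_of_memLp m1 m2)]
    simp_rw [integral_inner hI, real_inner_comm (∫ x, h x ∂P)]
    rw [integral_inner hI, real_inner_self_eq_norm_sq]
  rw [← c0, ← cn, ← Finset.sum_range_sub', Finset.sum_range, Finset.mul_sum]
  refine Finset.sum_le_sum fun i _ => ?_
  have hins : {j : Fin n | j.val < i.val + 1} = insert i {j : Fin n | j.val < i.val} := by
    ext j; simp [Fin.ext_iff]; omega
  simp only [hc, hins, ← swapOn_singleton_fst]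
  exact integral_inner_swapOn_sub_le hh (by simp)

end EfronStein

section Expectation

open Matrix

variable {Ω : Type*} [MeasurableSpace Ω] {μ : Measure Ω} {d : ℕ} {Z : Ω → Mat d}

lemma expMat_mulVec (hZ : MatIntegrable μ Z) (v : Fin d → ℂ) (k : Fin d) :
    (expMat μ Z *ᵥ v) k = ∫ ω, (Z ω *ᵥ v) k ∂μ := by
  simp only [expMat, mulVec, dotProduct, of_apply]
  rw [integral_finsetSum _ fun j _ => (hZ k j).mul_const _]
  simp_rw [integral_mul_const]

lemma MatIntegrable.mulVec (hZ : MatIntegrable μ Z) (v : Fin d → ℂ) (k : Fin d) :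
    Integrable (fun ω => (Z ω *ᵥ v) k) μ := by
  simp only [Matrix.mulVec, dotProduct]
  exact integrable_finsetSum _ fun j _ => (hZ k j).mul_const _

lemma dotProduct_expMat_mulVec (hZ : MatIntegrable μ Z) (v : Fin d → ℂ) :
    star v ⬝ᵥ (expMat μ Z *ᵥ v) = ∫ ω, star v ⬝ᵥ (Z ω *ᵥ v) ∂μ := by
  simp only [dotProduct, expMat_mulVec hZ]
  rw [integral_finsetSum _ fun k _ => (hZ.mulVec v k).const_mul _]
  simp_rw [integral_const_mul]

lemma isHermitian_expMat (hZ : ∀ ω, (Z ω).IsHermitian) : (expMat μ Z).IsHermitian := by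
  ext i j
  simp only [expMat, conjTranspose_apply, of_apply]
  rw [RCLike.star_def, ← integral_conj]
  exact integral_congr_ae (ae_of_all _ fun ω => (hZ ω).apply i j)

lemma Matrix.IsHermitian.dotProduct_sq_mulVec {A : Mat d} (hA : A.IsHermitian) (v : Fin d → ℂ) :
    star v ⬝ᵥ (A ^ 2 *ᵥ v) = ((∑ k, ‖(A *ᵥ v) k‖ ^ 2 : ℝ) : ℂ) := by
  rw [pow_two, ← mulVec_mulVec, dotProduct_mulVec, ← hA.eq, ← star_mulVec, hA.eq]
  simp [dotProduct, Complex.conj_mul']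

lemma memLp_two_of_matIntegrable_sq (hm : ∀ i j, AEStronglyMeasurable (fun ω => Z ω i j) μ)
    (hZ : ∀ ω, (Z ω).IsHermitian) (hint2 : MatIntegrable μ fun ω => Z ω ^ 2) (i j : Fin d) :
    MemLp (fun ω => Z ω i j) 2 μ := by
  rw [memLp_two_iff_integrable_sq_norm (hm i j)]
  refine (hint2 i i).norm.mono' ((hm i j).norm.pow 2) (ae_of_all _ fun ω => ?_)
  have h : (Z ω ^ 2) i i = ((∑ k, ‖Z ω i k‖ ^ 2 : ℝ) : ℂ) := by
    rw [pow_two, mul_apply]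
    push_cast
    refine Finset.sum_congr rfl fun k _ => ?_
    rw [← (hZ ω).apply k i, RCLike.star_def, Complex.mul_conj']
  dsimp only
  rw [h, Complex.norm_real, Real.norm_of_nonneg (by positivity),
    Real.norm_of_nonneg (by positivity)]
  exact Finset.single_le_sum (f := fun k => ‖Z ω i k‖ ^ 2) (fun _ _ => by positivity)
    (Finset.mem_univ j)

lemma matIntegrable_sq_of_memLp (hZ : ∀ i j, MemLp (fun ω => Z ω i j) 2 μ) :
    MatIntegrable μ fun ω => Z ω ^ 2 := fun i j => by
  simp only [pow_two, mul_apply]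
  exact integrable_finsetSum _ fun k _ => (hZ i k).integrable_mul (hZ k j)

lemma dotProduct_expMat_sq_mulVec (hZ : ∀ ω, (Z ω).IsHermitian)
    (hL : ∀ i j, MemLp (fun ω => Z ω i j) 2 μ) (v : Fin d → ℂ) :
    star v ⬝ᵥ (expMat μ (fun ω => Z ω ^ 2) *ᵥ v) =
      ((∑ k, ∫ ω, ‖(Z ω *ᵥ v) k‖ ^ 2 ∂μ : ℝ) : ℂ) := by
  rw [dotProduct_expMat_mulVec (matIntegrable_sq_of_memLp hL)]
  simp_rw [(hZ _).dotProduct_sq_mulVec]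
  rw [integral_complex_ofReal, integral_finsetSum _ fun k _ => ?_]
  have : MemLp (fun ω => (Z ω *ᵥ v) k) 2 μ := by
    simp only [mulVec, dotProduct]
    exact memLp_finsetSum _ fun j _ => (hL k j).mul_const _
  exact this.norm.integrable_sq

end Expectation

/-- **Operator Efron–Stein inequality.**
Independence of `X₁, …, Xₙ` and of the fresh copies `X₁', …, Xₙ'` is modelled by working on
the product probability space `(Π i, Ω i) × (Π i, Ω i)` equipped with the product measure;
`Z = f x` and `Z⁽ⁱ⁾ = f (update x i (x' i))`. -/
theorem operator_efron_stein {d n : ℕ} {Ω : Fin n → Type*} [∀ i, MeasurableSpace (Ω i)]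
    (μ : ∀ i, Measure (Ω i)) [∀ i, IsProbabilityMeasure (μ i)]
    (f : (∀ i, Ω i) → Mat d)
    (hmeas : ∀ i j, Measurable fun x => f x i j)
    (hpsd : ∀ x, (f x).PosSemidef)
    (hint : MatIntegrable (Measure.pi μ) f)
    (hint2 : MatIntegrable (Measure.pi μ) (fun x => f x ^ 2)) :
    LoewnerLE
      (expMat (Measure.pi μ) (fun x => f x ^ 2) - (expMat (Measure.pi μ) f) ^ 2)
      ((1 / 2 : ℝ) • ∑ i : Fin n,
        expMat ((Measure.pi μ).prod (Measure.pi μ))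
          (fun p => (f p.1 - f (Function.update p.1 i (p.2 i))) ^ 2)) := by
  have hH : ∀ x, (f x).IsHermitian := fun x => (hpsd x).1
  have hL := memLp_two_of_matIntegrable_sq (fun i j => (hmeas i j).aestronglyMeasurable) hH hint2
  have hD : ∀ i (p : (∀ i, Ω i) × (∀ i, Ω i)), (f p.1 - f (Function.update p.1 i (p.2 i))).IsHermitian :=
    fun i p => (hH _).sub (hH _)
  have hLD : ∀ i k l, MemLp (fun p : (∀ i, Ω i) × (∀ i, Ω i) =>
      (f p.1 - f (Function.update p.1 i (p.2 i))) k l) 2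
      ((Measure.pi μ).prod (Measure.pi μ)) := fun i k l => by
    simp only [Matrix.sub_apply, ← swapOn_singleton_fst]
    exact ((hL k l).comp_measurePreserving measurePreserving_fst).sub (memLp_swapOn (hL k l) {i})
  have hLv : ∀ (v : Fin d → ℂ) k, MemLp (fun x => (f x).mulVec v k) 2 (Measure.pi μ) :=
    fun v k => by
    simp only [Matrix.mulVec, dotProduct]
    exact memLp_finsetSum _ fun j _ => (hL k j).mul_const _
  have hE := isHermitian_expMat (μ := Measure.pi μ) hH
  refine Matrix.PosSemidef.of_dotProduct_mulVec_nonneg ?_ fun v => ?_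
  · refine Matrix.IsHermitian.sub ?_
      ((isHermitian_expMat fun x => (hH x).pow 2).sub (hE.pow 2))
    rw [Matrix.IsHermitian, Matrix.conjTranspose_smul, Matrix.conjTranspose_sum, star_trivial]
    exact congrArg _ (Finset.sum_congr rfl fun i _ => isHermitian_expMat fun p => (hD i p).pow 2)
  · rw [Matrix.sub_mulVec, Matrix.sub_mulVec, Matrix.smul_mulVec, Matrix.sum_mulVec,
      dotProduct_sub, dotProduct_sub, dotProduct_smul, dotProduct_sum,
      dotProduct_expMat_sq_mulVec hH hL, hE.dotProduct_sq_mulVec]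
    simp_rw [dotProduct_expMat_sq_mulVec (hD _) (hLD _), expMat_mulVec hint]
    rw [Complex.real_smul]
    norm_cast
    rw [sub_nonneg, ← Finset.sum_sub_distrib, Finset.sum_comm, Finset.mul_sum]
    refine Finset.sum_le_sum fun k _ => ?_
    simpa only [Matrix.sub_mulVec, Pi.sub_apply] using efron_stein (hLv v k)
end
end

section
/- Matrix polynomial Efron–Stein inequality: Let X₁,…,Xₙ be independent random variables and let Z = f(X₁,…,Xₙ) be a d×d positive semidefinite random matrix such that Z and Z² are Bochner integrable. Let X₁′,…,Xₙ′ be independent copies of X₁,…,Xₙ, and for each i set Z⁽ⁱ⁾ = f(X₁,…,X_{i−1}, Xᵢ′, X_{i+1},…,Xₙ). Then for each natural number p ≥ 1, ‖E[(Z − E[Z])²]‖_p^p ≤ ‖(1/2)·Σ_{i=1}^n E[(Z − Z⁽ⁱ⁾)²]‖_p^p. -/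
open MeasureTheory
open scoped ComplexOrder

noncomputable section

/-- The singular values of a matrix: square roots of the eigenvalues of `Mᴴ * M`. -/
def singularValues {d : ℕ} (M : Mat d) (i : Fin d) : ℝ :=
  Real.sqrt ((Matrix.posSemidef_conjTranspose_mul_self M).1.eigenvalues i)

/-- The Schatten `p`-norm `‖M‖_p = (∑ i |σ i (M)| ^ p) ^ (1/p)`. -/
def schattenNorm {d : ℕ} (p : ℝ) (M : Mat d) : ℝ :=
  (∑ i, |singularValues M i| ^ p) ^ (1 / p)

lemma inner_toEuclideanLin_self_eq_sum {d : ℕ} {A : Mat d}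
    (u : OrthonormalBasis (Fin d) ℂ (EuclideanSpace ℂ (Fin d))) (a : Fin d → ℝ)
    (hu : ∀ i, Matrix.toEuclideanLin A (u i) = (a i : ℂ) • u i) (x : EuclideanSpace ℂ (Fin d)) :
    inner ℂ x (Matrix.toEuclideanLin A x) = ((∑ j, ‖inner ℂ (u j) x‖ ^ 2 * a j : ℝ) : ℂ) := by
  have h : Matrix.toEuclideanLin A x = ∑ j, (inner ℂ (u j) x * (a j : ℂ)) • u j := by
    conv_lhs => rw [← u.sum_repr' x]
    simp only [map_sum, map_smul, hu, smul_smul]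
  rw [h, inner_sum]
  push_cast
  refine Finset.sum_congr rfl fun j _ => ?_
  rw [inner_smul_right, ← inner_conj_symm x (u j), mul_right_comm, RCLike.mul_conj]
  rfl

/-- A positive semidefinite matrix acts diagonally, by its singular values, on an eigenbasis of
`Mᴴ * M`. -/
lemma exists_orthonormalBasis_singularValues {d : ℕ} {M : Mat d} (hM : M.PosSemidef) :
    ∃ u : OrthonormalBasis (Fin d) ℂ (EuclideanSpace ℂ (Fin d)),
      ∀ i, Matrix.toEuclideanLin M (u i) = (singularValues M i : ℂ) • u i := by
  have hMM := Matrix.posSemidef_conjTranspose_mul_self M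
  refine ⟨hMM.1.eigenvectorBasis, fun i => ?_⟩
  set u := hMM.1.eigenvectorBasis i
  set s := singularValues M i
  set T := Matrix.toEuclideanLin M
  have hT : T.IsPositive := Matrix.isPositive_toEuclideanLin_iff.2 hM
  have hs0 : 0 ≤ s := Real.sqrt_nonneg _
  have hss : s * s = hMM.1.eigenvalues i := Real.mul_self_sqrt (hMM.eigenvalues_nonneg i)
  have hTT : T (T u) = ((s * s : ℝ) : ℂ) • u := by
    have h := hMM.1.mulVec_eigenvectorBasis i
    have hmul : ∀ x, (M.conjTranspose * M).mulVec x = M.mulVec (M.mulVec x) := fun x => by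
      rw [Matrix.mulVec_mulVec, hM.1.eq]
    rw [← hss, hmul] at h
    ext k
    have hk := congrFun h k
    simpa [T, Matrix.toLpLin_apply] using hk
  set w := T u - (s : ℂ) • u with hw
  have hTw : T w = -((s : ℂ) • w) := by
    rw [hw, map_sub, hTT, map_smul, smul_sub, smul_smul]
    push_cast
    abel
  have hpos := hT.2 w
  rw [hTw, inner_neg_left, inner_smul_left, Complex.conj_ofReal, inner_self_eq_norm_sq_to_K]
    at hpos
  have hpos' : 0 ≤ -(s * ‖w‖ ^ 2) := by
    have h : -((s : ℂ) * (‖w‖ : ℂ) ^ 2) = ((-(s * ‖w‖ ^ 2) : ℝ) : ℂ) := by push_cast; ring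
    have h' : (0 : ℝ) ≤ RCLike.re (-((s : ℂ) * (‖w‖ : ℂ) ^ 2)) := hpos
    rw [h] at h'
    simpa only [RCLike.re_to_complex, Complex.ofReal_re] using h'
  suffices h : w = 0 from sub_eq_zero.1 h
  rcases hs0.eq_or_lt with h0 | h0
  · have hw' : w = T u := by simp [hw, ← h0]
    have : inner ℂ w w = 0 := by
      nth_rewrite 2 [hw']
      rw [← hT.1 w u, hTw, ← h0]
      simp
    exact inner_self_eq_zero.1 this
  · have : ‖w‖ ^ 2 = 0 := by nlinarith [sq_nonneg ‖w‖]
    simpa using this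

lemma schattenNorm_pow_eq_sum {d : ℕ} (M : Mat d) {p : ℕ} (hp : 1 ≤ p) :
    schattenNorm p M ^ p = ∑ i, singularValues M i ^ p := by
  have h0 : ∀ i, 0 ≤ singularValues M i := fun i => Real.sqrt_nonneg _
  rw [schattenNorm, one_div, Real.rpow_inv_natCast_pow _ (by omega)]
  · simp [abs_of_nonneg (h0 _)]
  · positivity

lemma schattenNorm_pow_le_of_loewnerLE {d : ℕ} {A B : Mat d} (hA : A.PosSemidef)
    (hAB : LoewnerLE A B) {p : ℕ} (hp : 1 ≤ p) :
    schattenNorm p A ^ p ≤ schattenNorm p B ^ p := by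
  have hB : B.PosSemidef := by simpa using hA.add hAB
  obtain ⟨u, hu⟩ := exists_orthonormalBasis_singularValues hA
  obtain ⟨w, hw⟩ := exists_orthonormalBasis_singularValues hB
  rw [schattenNorm_pow_eq_sum A hp, schattenNorm_pow_eq_sum B hp]
  have hA0 : ∀ i, 0 ≤ singularValues A i := fun i => Real.sqrt_nonneg _
  have hB0 : ∀ i, 0 ≤ singularValues B i := fun i => Real.sqrt_nonneg _
  have hle : ∀ i, singularValues A i ≤ ∑ j, ‖inner ℂ (w j) (u i)‖ ^ 2 * singularValues B j := by
    intro i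
    have h := (Matrix.isPositive_toEuclideanLin_iff.2 hAB).re_inner_nonneg_right (u i)
    rw [map_sub, LinearMap.sub_apply, inner_sub_right,
      inner_toEuclideanLin_self_eq_sum w _ hw, hu, inner_smul_right, inner_self_eq_norm_sq_to_K,
      u.norm_eq_one i] at h
    have h' : (0 : ℝ) ≤ ((∑ j, ‖inner ℂ (w j) (u i)‖ ^ 2 * singularValues B j : ℝ) : ℂ).re
      - (singularValues A i : ℂ).re := by simpa using h
    simpa only [Complex.ofReal_re, sub_nonneg] using h'
  calc ∑ i, singularValues A i ^ p
      ≤ ∑ i, (∑ j, ‖inner ℂ (w j) (u i)‖ ^ 2 * singularValues B j) ^ p := by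
        gcongr with i
        · exact hA0 i
        · exact hle i
    _ ≤ ∑ i, ∑ j, ‖inner ℂ (w j) (u i)‖ ^ 2 * singularValues B j ^ p := by
        refine Finset.sum_le_sum fun i _ =>
          Real.pow_arith_mean_le_arith_mean_pow _ _ _ (fun j _ => by positivity) ?_
            (fun j _ => hB0 j) p
        rw [w.sum_sq_norm_inner_right, u.norm_eq_one, one_pow]
    _ = ∑ j, singularValues B j ^ p := by
        rw [Finset.sum_comm]
        refine Finset.sum_congr rfl fun j _ => ?_
        rw [← Finset.sum_mul]
        simp_rw [norm_inner_symm (w j)]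
        rw [u.sum_sq_norm_inner_right, w.norm_eq_one, one_pow, one_mul]

/-- Entrywise square integrability of a matrix-valued random variable. -/
def MatMemLpTwo {α : Type*} [MeasurableSpace α] (ν : Measure α) {d : ℕ}
    (Z : α → Mat d) : Prop := ∀ i j, MemLp (fun ω => Z ω i j) 2 ν

section Expectation

variable {α β : Type*} [MeasurableSpace α] [MeasurableSpace β] {ν : Measure α} {ρ : Measure β}
  {d : ℕ} {Y Z : α → Mat d}

lemma MatMemLpTwo.sub (hY : MatMemLpTwo ν Y) (hZ : MatMemLpTwo ν Z) :
    MatMemLpTwo ν (fun ω => Y ω - Z ω) :=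
  fun i j => (hY i j).sub (hZ i j)

lemma matMemLpTwo_const [IsFiniteMeasure ν] (M : Mat d) : MatMemLpTwo ν (fun _ => M) :=
  fun i j => memLp_const (M i j)

lemma MatMemLpTwo.comp_measurePreserving {W : β → Mat d} (hW : MatMemLpTwo ρ W) {φ : α → β}
    (hφ : MeasurePreserving φ ν ρ) : MatMemLpTwo ν (fun ω => W (φ ω)) :=
  fun i j => (hW i j).comp_measurePreserving hφ

lemma MatMemLpTwo.mul (hY : MatMemLpTwo ν Y) (hZ : MatMemLpTwo ν Z) :
    MatIntegrable ν (fun ω => Y ω * Z ω) := fun i j => by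
  simp only [Matrix.mul_apply]
  exact integrable_finsetSum _ fun k _ => (hY i k).integrable_mul (hZ k j)

lemma MatMemLpTwo.sq (hZ : MatMemLpTwo ν Z) : MatIntegrable ν (fun ω => Z ω ^ 2) := by
  simpa only [pow_two] using hZ.mul hZ

lemma MatMemLpTwo.of_sq (hmeas : ∀ i j, AEStronglyMeasurable (fun ω => Z ω i j) ν)
    (hherm : ∀ ω, (Z ω).IsHermitian) (hZ : MatIntegrable ν (fun ω => Z ω ^ 2)) :
    MatMemLpTwo ν Z := fun i j => by
  rw [memLp_two_iff_integrable_sq_norm (hmeas i j)]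
  have hsq : ∀ ω, (Z ω ^ 2) i i = ((∑ k, ‖Z ω i k‖ ^ 2 : ℝ) : ℂ) := fun ω => by
    rw [pow_two, Matrix.mul_apply]
    push_cast
    refine Finset.sum_congr rfl fun k _ => ?_
    rw [← (hherm ω).apply k i, ← Complex.mul_conj']
    rfl
  refine Integrable.mono' (g := fun ω => ‖(Z ω ^ 2) i i‖) (hZ i i).norm
    ((hmeas i j).norm.pow 2) (.of_forall fun ω => ?_)
  rw [hsq, Complex.norm_real, Real.norm_of_nonneg (by positivity),
    Real.norm_of_nonneg (by positivity)]
  exact Finset.single_le_sum (f := fun k => ‖Z ω i k‖ ^ 2) (fun k _ => by positivity)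
    (Finset.mem_univ j)

lemma expMat_add (hY : MatIntegrable ν Y) (hZ : MatIntegrable ν Z) :
    expMat ν (fun ω => Y ω + Z ω) = expMat ν Y + expMat ν Z := by
  ext i j
  exact integral_add (hY i j) (hZ i j)

lemma MatIntegrable.add (hY : MatIntegrable ν Y) (hZ : MatIntegrable ν Z) :
    MatIntegrable ν (fun ω => Y ω + Z ω) :=
  fun i j => (hY i j).add (hZ i j)

lemma expMat_sub (hY : MatIntegrable ν Y) (hZ : MatIntegrable ν Z) :
    expMat ν (fun ω => Y ω - Z ω) = expMat ν Y - expMat ν Z := by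
  ext i j
  exact integral_sub (hY i j) (hZ i j)

lemma expMat_comp_measurePreserving {W : β → Mat d} (hW : MatIntegrable ρ W) {φ : α → β}
    (hφ : MeasurePreserving φ ν ρ) : expMat ν (fun ω => W (φ ω)) = expMat ρ W := by
  ext i j
  simp only [expMat, Matrix.of_apply]
  rw [← hφ.map_eq, integral_map hφ.aemeasurable (hφ.map_eq ▸ (hW i j).aestronglyMeasurable)]

lemma expMat_const_mul (M : Mat d) (hZ : MatIntegrable ν Z) :
    expMat ν (fun ω => M * Z ω) = M * expMat ν Z := by
  ext i j
  simp only [expMat, Matrix.of_apply, Matrix.mul_apply]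
  rw [integral_finsetSum _ fun k _ => (hZ k j).const_mul _]
  simp only [integral_const_mul]

lemma expMat_mul_const (M : Mat d) (hZ : MatIntegrable ν Z) :
    expMat ν (fun ω => Z ω * M) = expMat ν Z * M := by
  ext i j
  simp only [expMat, Matrix.of_apply, Matrix.mul_apply]
  rw [integral_finsetSum _ fun k _ => (hZ i k).mul_const _]
  simp only [integral_mul_const]

lemma expMat_const [IsProbabilityMeasure ν] (M : Mat d) : expMat ν (fun _ => M) = M := by
  ext i j
  simp [expMat]

lemma expMat_prod_mul [SFinite ν] [SFinite ρ] {W : β → Mat d}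
    (hZ : MatMemLpTwo (ν.prod ρ) (fun q => Z q.1)) (hW : MatMemLpTwo (ν.prod ρ) (fun q => W q.2)) :
    expMat (ν.prod ρ) (fun q => Z q.1 * W q.2) = expMat ν Z * expMat ρ W := by
  ext i j
  simp only [expMat, Matrix.of_apply, Matrix.mul_apply]
  refine (integral_finsetSum _ fun k _ => (hZ i k).integrable_mul (hW k j)).trans ?_
  exact Finset.sum_congr rfl fun k _ => integral_prod_mul (fun x => Z x i k) (fun y => W y k j)

lemma expMat_isHermitian (hZ : ∀ ω, (Z ω).IsHermitian) : (expMat ν Z).IsHermitian := by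
  ext i j
  simp only [Matrix.conjTranspose_apply, expMat, Matrix.of_apply]
  rw [Complex.star_def, ← integral_conj]
  exact integral_congr_ae (.of_forall fun ω => (hZ ω).apply i j)

lemma expMat_posSemidef (hint : MatIntegrable ν Z) (hZ : ∀ ω, (Z ω).PosSemidef) :
    (expMat ν Z).PosSemidef := by
  refine .of_dotProduct_mulVec_nonneg (expMat_isHermitian fun ω => (hZ ω).1) fun x => ?_
  have h : star x ⬝ᵥ (expMat ν Z).mulVec x = ∫ ω, star x ⬝ᵥ (Z ω).mulVec x ∂ν := by
    simp only [dotProduct, Matrix.mulVec, expMat, Matrix.of_apply]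
    rw [integral_finsetSum _ fun i _ =>
      (integrable_finsetSum _ fun j _ => (hint i j).mul_const _).const_mul _]
    refine Finset.sum_congr rfl fun i _ => ?_
    rw [integral_const_mul, integral_finsetSum _ fun j _ => (hint i j).mul_const _]
    simp only [integral_mul_const]
  rw [h]
  exact integral_nonneg fun ω => (hZ ω).dotProduct_mulVec_nonneg x

lemma Matrix.IsHermitian.sq_posSemidef {A : Mat d} (hA : A.IsHermitian) : (A ^ 2).PosSemidef := by
  have h := Matrix.posSemidef_conjTranspose_mul_self A
  rwa [hA.eq, ← pow_two] at h

end Expectation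

section Resampling

variable {ι : Type*} [DecidableEq ι] {Ω : ι → Type*} [∀ i, MeasurableSpace (Ω i)]

/-- Exchange the coordinates in `T` between the two points of a pair. -/
def swapCoords (T : Finset ι) (q : (∀ i, Ω i) × (∀ i, Ω i)) : (∀ i, Ω i) × (∀ i, Ω i) :=
  (T.piecewise q.2 q.1, T.piecewise q.1 q.2)

lemma measurable_swapCoords (T : Finset ι) : Measurable (swapCoords (Ω := Ω) T) := by
  refine Measurable.prodMk (measurable_pi_iff.2 fun i => ?_) (measurable_pi_iff.2 fun i => ?_) <;>
  · by_cases h : i ∈ T <;> simp only [Finset.piecewise, h, if_true, if_false] <;> fun_prop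

variable [Fintype ι]

lemma measurePreserving_swapCoords (μ : ∀ i, Measure (Ω i)) [∀ i, IsProbabilityMeasure (μ i)]
    (T : Finset ι) :
    MeasurePreserving (swapCoords T) ((Measure.pi μ).prod (Measure.pi μ))
      ((Measure.pi μ).prod (Measure.pi μ)) := by
  refine ⟨measurable_swapCoords T, Eq.symm ?_⟩
  have hspan : (Measure.pi μ).FiniteSpanningSetsIn
      (Set.univ.pi '' Set.univ.pi fun i => {s : Set (Ω i) | MeasurableSet s}) :=
    ⟨fun _ => Set.univ, fun _ => ⟨fun _ => Set.univ, by simp, by simp⟩, fun _ => by simp,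
      Set.iUnion_const _⟩
  refine Measure.prod_eq_generateFrom generateFrom_pi generateFrom_pi isPiSystem_pi isPiSystem_pi
    hspan hspan ?_
  rintro _ ⟨s, hs, rfl⟩ _ ⟨t, ht, rfl⟩
  have hs' : ∀ i, MeasurableSet (s i) := fun i => hs i trivial
  have ht' : ∀ i, MeasurableSet (t i) := fun i => ht i trivial
  rw [Measure.map_apply (measurable_swapCoords T)
    ((MeasurableSet.univ_pi hs').prod (MeasurableSet.univ_pi ht'))]
  have hpre : swapCoords T ⁻¹' (Set.univ.pi s ×ˢ Set.univ.pi t)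
      = Set.univ.pi (T.piecewise t s) ×ˢ Set.univ.pi (T.piecewise s t) := by
    ext q
    simp only [swapCoords, Set.mem_preimage, Set.mem_prod, Set.mem_univ_pi, ← forall_and]
    refine forall_congr' fun i => ?_
    by_cases h : i ∈ T <;> simp [h, and_comm]
  rw [hpre, Measure.prod_prod, Measure.pi_pi, Measure.pi_pi, Measure.pi_pi, Measure.pi_pi,
    ← Finset.prod_mul_distrib, ← Finset.prod_mul_distrib]
  refine Finset.prod_congr rfl fun i _ => ?_
  by_cases h : i ∈ T <;> simp [h, mul_comm]

/-- The expected squared change of `f` when the coordinates in `T` are resampled. -/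
def resampleSq {d : ℕ} (μ : ∀ i, Measure (Ω i)) (f : (∀ i, Ω i) → Mat d) (T : Finset ι) : Mat d :=
  expMat ((Measure.pi μ).prod (Measure.pi μ)) fun q => (f q.1 - f (swapCoords T q).1) ^ 2

variable {d : ℕ} (μ : ∀ i, Measure (Ω i)) [∀ i, IsProbabilityMeasure (μ i)]
  {f : (∀ i, Ω i) → Mat d}

lemma loewnerLE_resampleSq_insert (hherm : ∀ x, (f x).IsHermitian)
    (hf : MatMemLpTwo (Measure.pi μ) f) {S : Finset ι} {i : ι} (hi : i ∉ S) :
    LoewnerLE (resampleSq μ f (insert i S)) (resampleSq μ f S + resampleSq μ f {i}) := by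
  set P := (Measure.pi μ).prod (Measure.pi μ)
  have hfst : MatMemLpTwo P (fun q => f q.1) := hf.comp_measurePreserving measurePreserving_fst
  have hG : ∀ T, MatMemLpTwo P (fun q => f (swapCoords T q).1) := fun T =>
    hfst.comp_measurePreserving (measurePreserving_swapCoords μ T)
  have e1 : ∀ q : (∀ i, Ω i) × (∀ i, Ω i),
      (swapCoords S (swapCoords {i} q)).1 = (swapCoords (insert i S) q).1 := by
    intro q
    ext j
    by_cases hj : j = i
    · subst hj; simp [swapCoords, hi]
    · by_cases hS : j ∈ S <;> simp [swapCoords, hj, hS]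
  have e2 : ∀ q : (∀ i, Ω i) × (∀ i, Ω i),
      (swapCoords {i} (swapCoords S q)).1 = (swapCoords (insert i S) q).1 := by
    intro q
    ext j
    by_cases hj : j = i
    · subst hj; simp [swapCoords, hi]
    · by_cases hS : j ∈ S <;> simp [swapCoords, hj, hS]
  have e3 : ∀ q : (∀ i, Ω i) × (∀ i, Ω i),
      (swapCoords (insert i S) (swapCoords S q)).1 = (swapCoords {i} q).1 := by
    intro q
    ext j
    by_cases hj : j = i
    · subst hj; simp [swapCoords, hi]
    · by_cases hS : j ∈ S <;> simp [swapCoords, hj, hS]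
  have h1 : expMat P (fun q => (f (swapCoords {i} q).1 - f (swapCoords (insert i S) q).1) ^ 2)
      = resampleSq μ f S := by
    simp_rw [← e1]
    exact expMat_comp_measurePreserving (hfst.sub (hG S)).sq (measurePreserving_swapCoords μ {i})
  have h2 : expMat P (fun q => (f (swapCoords S q).1 - f (swapCoords (insert i S) q).1) ^ 2)
      = resampleSq μ f {i} := by
    simp_rw [← e2]
    exact expMat_comp_measurePreserving (hfst.sub (hG {i})).sq (measurePreserving_swapCoords μ S)
  have h3 : expMat P (fun q => (f (swapCoords S q).1 - f (swapCoords {i} q).1) ^ 2)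
      = resampleSq μ f (insert i S) := by
    simp_rw [← e3]
    exact expMat_comp_measurePreserving (hfst.sub (hG _)).sq (measurePreserving_swapCoords μ S)
  set W : (∀ i, Ω i) × (∀ i, Ω i) → Mat d := fun q =>
    (f q.1 - f (swapCoords S q).1) - (f (swapCoords {i} q).1 - f (swapCoords (insert i S) q).1)
    with hW
  have hWm : MatMemLpTwo P W := (hfst.sub (hG S)).sub ((hG {i}).sub (hG (insert i S)))
  have hWpos : (expMat P (fun q => W q ^ 2)).PosSemidef :=
    expMat_posSemidef hWm.sq fun q =>
      (((hherm _).sub (hherm _)).sub ((hherm _).sub (hherm _))).sq_posSemidef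
  have hquad : expMat P (fun q => W q ^ 2)
      = (2 : ℝ) • (resampleSq μ f S + resampleSq μ f {i} - resampleSq μ f (insert i S)) := by
    have hpt : (fun q => W q ^ 2) = fun q =>
        ((f q.1 - f (swapCoords S q).1) ^ 2
          + (f (swapCoords {i} q).1 - f (swapCoords (insert i S) q).1) ^ 2
          + ((f q.1 - f (swapCoords {i} q).1) ^ 2
          + (f (swapCoords S q).1 - f (swapCoords (insert i S) q).1) ^ 2))
          - ((f q.1 - f (swapCoords (insert i S) q).1) ^ 2
          + (f (swapCoords S q).1 - f (swapCoords {i} q).1) ^ 2) := by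
      funext q
      simp only [hW]
      noncomm_ring
    have i1 := (hfst.sub (hG S)).sq
    have i2 := ((hG {i}).sub (hG (insert i S))).sq
    have i3 := (hfst.sub (hG {i})).sq
    have i4 := ((hG S).sub (hG (insert i S))).sq
    have i5 := (hfst.sub (hG (insert i S))).sq
    have i6 := ((hG S).sub (hG {i})).sq
    rw [hpt, expMat_sub ((i1.add i2).add (i3.add i4)) (i5.add i6),
      expMat_add (i1.add i2) (i3.add i4), expMat_add i1 i2, expMat_add i3 i4, expMat_add i5 i6,
      h1, h2, h3, two_smul]
    change (resampleSq μ f S + _) + (resampleSq μ f {i} + _) - (resampleSq μ f (insert i S) + _) = _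
    abel
  have hhalf := hWpos.smul (show (0 : ℝ) ≤ 1 / 2 by norm_num)
  rw [hquad, smul_smul] at hhalf
  norm_num at hhalf
  exact hhalf

lemma resampleSq_le_sum (hherm : ∀ x, (f x).IsHermitian) (hf : MatMemLpTwo (Measure.pi μ) f)
    (S : Finset ι) : LoewnerLE (resampleSq μ f S) (∑ i ∈ S, resampleSq μ f {i}) := by
  induction S using Finset.induction_on with
  | empty =>
    have h : resampleSq μ f ∅ = 0 := by
      ext i j
      simp [resampleSq, swapCoords, expMat]
    simpa [LoewnerLE, h] using Matrix.PosSemidef.zero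
  | insert i S hi ih =>
    have h := (loewnerLE_resampleSq_insert μ hherm hf hi).add ih
    rw [Finset.sum_insert hi, LoewnerLE]
    convert h using 1
    abel

lemma resampleSq_univ (hf : MatMemLpTwo (Measure.pi μ) f) :
    resampleSq μ f Finset.univ
      = (2 : ℝ) • expMat (Measure.pi μ) (fun x => (f x - expMat (Measure.pi μ) f) ^ 2) := by
  set m := Measure.pi μ
  set M := expMat m f with hM
  have h1 : MatMemLpTwo (m.prod m) (fun q => f q.1) :=
    hf.comp_measurePreserving measurePreserving_fst
  have h2 : MatMemLpTwo (m.prod m) (fun q => f q.2) :=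
    hf.comp_measurePreserving measurePreserving_snd
  have hint : MatIntegrable m f := fun i j => (hf i j).integrable one_le_two
  have hMc : MatMemLpTwo m (fun _ => M) := matMemLpTwo_const M
  have hvar : expMat m (fun x => (f x - M) ^ 2) = expMat m (fun x => f x ^ 2) - M * M := by
    have hpt : (fun x => (f x - M) ^ 2) = fun x => (f x ^ 2 + M * M) - (f x * M + M * f x) := by
      funext x
      noncomm_ring
    rw [hpt, expMat_sub (hf.sq.add (hMc.mul hMc)) ((hf.mul hMc).add (hMc.mul hf)),
      expMat_add hf.sq (hMc.mul hMc), expMat_add (hf.mul hMc) (hMc.mul hf), expMat_const,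
      expMat_const_mul M hint, expMat_mul_const M hint, ← hM]
    abel
  have hpair : resampleSq μ f Finset.univ = expMat (m.prod m)
      (fun q => (f q.1 ^ 2 + f q.2 ^ 2) - (f q.1 * f q.2 + f q.2 * f q.1)) := by
    have hpt : (fun q : (∀ i, Ω i) × (∀ i, Ω i) => (f q.1 - f (swapCoords Finset.univ q).1) ^ 2)
        = fun q => (f q.1 ^ 2 + f q.2 ^ 2) - (f q.1 * f q.2 + f q.2 * f q.1) := by
      funext q
      simp only [swapCoords, Finset.piecewise_univ]
      noncomm_ring
    rw [resampleSq, hpt]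
  have hswap : expMat (m.prod m) (fun q => f q.2 * f q.1) = M * M := by
    rw [← expMat_prod_mul h1 h2]
    exact expMat_comp_measurePreserving (h1.mul h2) Measure.measurePreserving_swap
  rw [hpair, expMat_sub (h1.sq.add h2.sq) ((h1.mul h2).add (h2.mul h1)), expMat_add h1.sq h2.sq,
    expMat_add (h1.mul h2) (h2.mul h1), hswap, expMat_prod_mul h1 h2,
    expMat_comp_measurePreserving hf.sq measurePreserving_fst,
    expMat_comp_measurePreserving hf.sq measurePreserving_snd, hvar, two_smul, ← hM]
  abel

end Resampling

/-- **Matrix polynomial Efron–Stein inequality.**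
Independence of `X₁, …, Xₙ` and of the fresh copies `X₁', …, Xₙ'` is modelled by working on
the product probability space `(Π i, Ω i) × (Π i, Ω i)` equipped with the product measure;
`Z = f x` and `Z⁽ⁱ⁾ = f (update x i (x' i))`. -/
theorem matrix_polynomial_efron_stein {d n : ℕ} {Ω : Fin n → Type*}
    [∀ i, MeasurableSpace (Ω i)]
    (μ : ∀ i, Measure (Ω i)) [∀ i, IsProbabilityMeasure (μ i)]
    (f : (∀ i, Ω i) → Mat d)
    (hmeas : ∀ i j, Measurable fun x => f x i j)
    (hpsd : ∀ x, (f x).PosSemidef)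
    (hint : MatIntegrable (Measure.pi μ) f)
    (hint2 : MatIntegrable (Measure.pi μ) (fun x => f x ^ 2))
    (p : ℕ) (hp : 1 ≤ p) :
    schattenNorm p
        (expMat (Measure.pi μ) (fun x => (f x - expMat (Measure.pi μ) f) ^ 2)) ^ (p : ℕ)
      ≤ schattenNorm p
        ((1 / 2 : ℝ) • ∑ i : Fin n,
          expMat ((Measure.pi μ).prod (Measure.pi μ))
            (fun q => (f q.1 - f (Function.update q.1 i (q.2 i))) ^ 2)) ^ (p : ℕ) := by
  have hherm : ∀ x, (f x).IsHermitian := fun x => (hpsd x).1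
  have hf : MatMemLpTwo (Measure.pi μ) f :=
    .of_sq (fun i j => (hmeas i j).aestronglyMeasurable) hherm hint2
  have hvar : MatMemLpTwo (Measure.pi μ) (fun x => f x - expMat (Measure.pi μ) f) :=
    hf.sub (matMemLpTwo_const _)
  refine schattenNorm_pow_le_of_loewnerLE (expMat_posSemidef hvar.sq fun x =>
    ((hherm x).sub (expMat_isHermitian hherm)).sq_posSemidef) ?_ hp
  have h := (resampleSq_le_sum μ hherm hf Finset.univ).smul (show (0 : ℝ) ≤ 1 / 2 by norm_num)
  rw [resampleSq_univ μ hf, smul_sub, smul_smul] at h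
  norm_num at h
  simpa [LoewnerLE, resampleSq, swapCoords, Finset.piecewise_singleton] using h
end
end

section
/- Equivalence of joint trace convexity and convexity of the matrix Φ-entropy functional: Let Φ : [0,∞) → ℝ be convex. The following are equivalent: (i) for every t ∈ [0,1], the map (u,v) ↦ Tr[t·Φ(u) + (1−t)·Φ(v) − Φ(t·u + (1−t)·v)] is jointly convex on pairs of d×d positive semidefinite matrices; (ii) for all random d×d positive semidefinite matrices X, Y defined on a common probability space (with X, Y, Φ(X), Φ(Y), Φ(tX+(1−t)Y) Bochner integrable) and all t ∈ [0,1], H_Φ(t·X + (1−t)·Y) ≤ t·H_Φ(X) + (1−t)·H_Φ(Y). -/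
open MeasureTheory
open scoped ComplexOrder

noncomputable section

/-- The standard matrix function induced by `Φ : ℝ → ℝ` on Hermitian matrices, obtained by
applying `Φ` to the eigenvalues in a spectral decomposition (junk value `0` off the
Hermitian matrices). -/
def matFun {d : ℕ} (Φ : ℝ → ℝ) (A : Mat d) : Mat d :=
  if hA : A.IsHermitian then
    (hA.eigenvectorUnitary : Mat d) *
      Matrix.diagonal (fun i => (Φ (hA.eigenvalues i) : ℂ)) *
      (star (hA.eigenvectorUnitary : Mat d))
  else 0

theorem matFun_isHermitian {d : ℕ} (Φ : ℝ → ℝ) (A : Mat d) : (matFun Φ A).IsHermitian := by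
  unfold matFun
  split
  · rename_i hA
    rw [Matrix.star_eq_conjTranspose]
    exact Matrix.isHermitian_mul_mul_conjTranspose _ (by
      rw [Matrix.IsHermitian, Matrix.diagonal_conjTranspose]
      have hstar : (star fun i => ((Φ (hA.eigenvalues i) : ℝ) : ℂ))
          = fun i => ((Φ (hA.eigenvalues i) : ℝ) : ℂ) :=
        funext fun i => Complex.conj_ofReal _
      rw [hstar])
  · exact Matrix.isHermitian_zero


/-- The normalized trace `tr[M] = Tr[M] / d` (real part; the trace of a Hermitian matrix
is real). -/
def ntr {d : ℕ} (M : Mat d) : ℝ := (Matrix.trace M).re / d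

/-- Real part of the (unnormalized) trace. -/
def TrRe {d : ℕ} (M : Mat d) : ℝ := (Matrix.trace M).re

/-- Convexity of the matrix `Φ`-entropy functional `H_Φ`: for all random positive semidefinite
matrices `X`, `Y` on a common probability space (with the relevant Bochner integrability)
and all `t ∈ [0,1]`, `H_Φ(tX + (1−t)Y) ≤ t H_Φ(X) + (1−t) H_Φ(Y)`. -/
def EntropyConvex (d : ℕ) (Φ : ℝ → ℝ) : Prop :=
  ∀ (Ω : Type) (_ : MeasurableSpace Ω) (μ : Measure Ω), IsProbabilityMeasure μ →
    ∀ X Y : Ω → Mat d,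
      (∀ i j, Measurable fun ω => X ω i j) → (∀ i j, Measurable fun ω => Y ω i j) →
      (∀ ω, (X ω).PosSemidef) → (∀ ω, (Y ω).PosSemidef) →
      MatIntegrable μ X → MatIntegrable μ Y →
      MatIntegrable μ (fun ω => matFun Φ (X ω)) →
      MatIntegrable μ (fun ω => matFun Φ (Y ω)) →
      ∀ t : ℝ, t ∈ Set.Icc (0 : ℝ) 1 →
      MatIntegrable μ (fun ω => matFun Φ (t • X ω + (1 - t) • Y ω)) →
      ntr (expMat μ (fun ω => matFun Φ (t • X ω + (1 - t) • Y ω))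
            - matFun Φ (expMat μ (fun ω => t • X ω + (1 - t) • Y ω)))
        ≤ t * ntr (expMat μ (fun ω => matFun Φ (X ω)) - matFun Φ (expMat μ X))
          + (1 - t) * ntr (expMat μ (fun ω => matFun Φ (Y ω)) - matFun Φ (expMat μ Y))

section TraceGap

open scoped Matrix.Norms.L2Operator

theorem matFun_eq_cfc {d : ℕ} (Φ : ℝ → ℝ) {A : Mat d} (hA : A.IsHermitian) :
    matFun Φ A = cfc Φ A := by
  rw [hA.cfc_eq, matFun, dif_pos hA, Matrix.IsHermitian.cfc, Unitary.conjStarAlgAut_apply]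
  rfl

theorem matFun_smul_one {d : ℕ} (Φ : ℝ → ℝ) (c : ℝ) :
    matFun Φ (c • (1 : Mat d)) = Φ c • (1 : Mat d) := by
  have hA : (c • (1 : Mat d)).IsHermitian := by
    rw [Matrix.IsHermitian, Matrix.conjTranspose_smul]; simp
  rw [matFun_eq_cfc Φ hA, ← Algebra.algebraMap_eq_smul_one, cfc_algebraMap,
    Algebra.algebraMap_eq_smul_one]

theorem TrRe_add {d : ℕ} (A B : Mat d) : TrRe (A + B) = TrRe A + TrRe B := by
  simp [TrRe]

theorem TrRe_sub {d : ℕ} (A B : Mat d) : TrRe (A - B) = TrRe A - TrRe B := by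
  simp [TrRe]

theorem TrRe_smul {d : ℕ} (c : ℝ) (A : Mat d) : TrRe (c • A) = c * TrRe A := by
  simp [TrRe]

theorem TrRe_one {d : ℕ} : TrRe (1 : Mat d) = d := by
  simp [TrRe]

theorem ntr_eq_TrRe_div {d : ℕ} (A : Mat d) : ntr A = TrRe A / d := rfl

theorem continuous_TrRe {d : ℕ} : Continuous (TrRe : Mat d → ℝ) :=
  Complex.continuous_re.comp (continuous_id.matrix_trace)

theorem isClosed_posSemidef {d : ℕ} : IsClosed {A : Mat d | A.PosSemidef} := by
  simp only [Matrix.posSemidef_iff_dotProduct_mulVec, Set.ofPred_and, Set.ofPred_forall]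
  refine IsClosed.inter ?_ (isClosed_iInter fun x => ?_)
  · exact isClosed_eq (continuous_id.matrix_conjTranspose) continuous_id
  · exact isClosed_le continuous_const
      (continuous_const.dotProduct (continuous_id.matrix_mulVec continuous_const))

theorem posSemidef_real_combination {d : ℕ} {A B : Mat d} (hA : A.PosSemidef) (hB : B.PosSemidef)
    {a b : ℝ} (ha : 0 ≤ a) (hb : 0 ≤ b) : (a • A + b • B).PosSemidef :=
  (hA.smul ha).add (hB.smul hb)

theorem spectrum_subset_Icc_of_posSemidef {d : ℕ} {A : Mat d} (hA : A.PosSemidef) {r : ℝ}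
    (hr : ‖A‖ ≤ r) : spectrum ℝ A ⊆ Set.Icc 0 r := by
  intro x hx
  constructor
  · rw [hA.1.spectrum_real_eq_range_eigenvalues] at hx
    obtain ⟨i, rfl⟩ := hx
    exact hA.eigenvalues_nonneg i
  · have h : (algebraMap ℝ ℂ x) ∈ spectrum ℂ A := (spectrum.algebraMap_mem_iff ℂ).mpr hx
    rcases isEmpty_or_nonempty (Fin d) with h0 | h0
    · simp [spectrum.of_subsingleton] at hx
    · have h1 := spectrum.norm_le_norm_of_mem h
      have h2 : |x| ≤ ‖A‖ := by simpa using h1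
      exact (le_abs_self x).trans (h2.trans hr)

theorem continuousOn_matFun {d : ℕ} {Φ : ℝ → ℝ} (hΦ : ContinuousOn Φ (Set.Ici 0)) :
    ContinuousOn (matFun Φ) {A : Mat d | A.PosSemidef} := by
  have key : ContinuousOn (fun A : Mat d => cfc Φ A) {A : Mat d | A.PosSemidef} := by
    refine ContinuousOn.cfc (s := fun A => Set.Icc 0 (‖A‖ + 1)) Φ (fun _ _ => isCompact_Icc)
      continuousOn_id ?_ (fun A hA => hA.1) (fun A _ => hΦ.mono Set.Icc_subset_Ici_self)
    intro A _
    have hnorm : ∀ᶠ B : Mat d in nhdsWithin A {A : Mat d | A.PosSemidef}, ‖B‖ < ‖A‖ + 1 :=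
      nhdsWithin_le_nhds (continuous_norm.continuousAt.eventually_lt_const (lt_add_one _))
    filter_upwards [hnorm, self_mem_nhdsWithin] with B hB hBpos
    exact spectrum_subset_Icc_of_posSemidef hBpos hB.le
  exact key.congr fun A hA => matFun_eq_cfc Φ hA.1

/-- The Jensen gap `Tr[t Φ(u) + (1 - t) Φ(v) - Φ(t u + (1 - t) v)]` at a pair `p = (u, v)`. -/
def traceGap {d : ℕ} (Φ : ℝ → ℝ) (t : ℝ) (p : Mat d × Mat d) : ℝ :=
  TrRe (t • matFun Φ p.1 + (1 - t) • matFun Φ p.2 - matFun Φ (t • p.1 + (1 - t) • p.2))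

theorem traceGap_eq {d : ℕ} (Φ : ℝ → ℝ) (t : ℝ) (p : Mat d × Mat d) :
    traceGap Φ t p = t * TrRe (matFun Φ p.1) + (1 - t) * TrRe (matFun Φ p.2)
      - TrRe (matFun Φ (t • p.1 + (1 - t) • p.2)) := by
  simp only [traceGap, TrRe_sub, TrRe_add, TrRe_smul]

theorem continuousOn_traceGap {d : ℕ} {Φ : ℝ → ℝ} (hΦ : ContinuousOn Φ (Set.Ici 0)) {t : ℝ}
    (ht : t ∈ Set.Icc (0 : ℝ) 1) :
    ContinuousOn (traceGap Φ t)
      ({A : Mat d | A.PosSemidef} ×ˢ {A : Mat d | A.PosSemidef}) := by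
  have hc := continuousOn_matFun (d := d) hΦ
  refine continuous_TrRe.comp_continuousOn (ContinuousOn.sub (ContinuousOn.add ?_ ?_) ?_)
  · exact (hc.comp continuousOn_fst fun p hp => hp.1).const_smul t
  · exact (hc.comp continuousOn_snd fun p hp => hp.2).const_smul (1 - t)
  · refine hc.comp (Continuous.continuousOn (by fun_prop)) fun p hp => ?_
    exact posSemidef_real_combination hp.1 hp.2 ht.1 (sub_nonneg.mpr ht.2)

section Expectation

variable {Ω : Type*} [MeasurableSpace Ω] {μ : Measure Ω} {d : ℕ}

theorem MatIntegrable.integrable {Z : Ω → Mat d} (hZ : MatIntegrable μ Z) : Integrable Z μ := by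
  have h : Z = fun ω => ∑ i, ∑ j, Z ω i j • Matrix.single i j (1 : ℂ) := by
    funext ω
    conv_lhs => rw [Matrix.matrix_eq_sum_single (Z ω)]
    simp
  rw [h]
  exact integrable_finsetSum _ fun i _ => integrable_finsetSum _ fun j _ =>
    (hZ i j).smul_const _

theorem MatIntegrable.integral_eq_expMat {Z : Ω → Mat d} (hZ : MatIntegrable μ Z) :
    ∫ ω, Z ω ∂μ = expMat μ Z := by
  ext i j
  let L : Mat d →L[ℝ] ℂ := LinearMap.toContinuousLinearMap (Matrix.entryLinearMap ℝ ℂ i j)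
  exact (L.integral_comp_comm hZ.integrable).symm

theorem MatIntegrable.integrable_TrRe {Z : Ω → Mat d} (hZ : MatIntegrable μ Z) :
    Integrable (fun ω => TrRe (Z ω)) μ := by
  simp only [TrRe, Matrix.trace]
  exact (integrable_finsetSum _ fun i _ => hZ i i).re

theorem MatIntegrable.integral_TrRe {Z : Ω → Mat d} (hZ : MatIntegrable μ Z) :
    ∫ ω, TrRe (Z ω) ∂μ = TrRe (expMat μ Z) := by
  have hint : Integrable (fun ω => ∑ i, Z ω i i) μ := integrable_finsetSum _ fun i _ => hZ i i
  have h := integral_re (𝕜 := ℂ) hint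
  rw [integral_finsetSum _ fun i _ => hZ i i] at h
  exact h

theorem expMat_real_combination {X Y : Ω → Mat d} (hX : MatIntegrable μ X)
    (hY : MatIntegrable μ Y) (a b : ℝ) :
    expMat μ (fun ω => a • X ω + b • Y ω) = a • expMat μ X + b • expMat μ Y := by
  ext i j
  refine (integral_add ((hX i j).smul a) ((hY i j).smul b)).trans ?_
  exact congrArg₂ (· + ·) (integral_smul a _) (integral_smul b _)

end Expectation

theorem integral_traceGap {Ω : Type*} [MeasurableSpace Ω] {μ : Measure Ω} {d : ℕ} {Φ : ℝ → ℝ}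
    {X Y : Ω → Mat d} {t : ℝ}
    (hX : MatIntegrable μ fun ω => matFun Φ (X ω)) (hY : MatIntegrable μ fun ω => matFun Φ (Y ω))
    (hXY : MatIntegrable μ fun ω => matFun Φ (t • X ω + (1 - t) • Y ω)) :
    Integrable (fun ω => traceGap Φ t (X ω, Y ω)) μ ∧
    ∫ ω, traceGap Φ t (X ω, Y ω) ∂μ =
      t * TrRe (expMat μ fun ω => matFun Φ (X ω))
        + (1 - t) * TrRe (expMat μ fun ω => matFun Φ (Y ω))
        - TrRe (expMat μ fun ω => matFun Φ (t • X ω + (1 - t) • Y ω)) := by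
  have h1 := hX.integrable_TrRe.const_mul t
  have h2 := hY.integrable_TrRe.const_mul (1 - t)
  simp only [traceGap_eq]
  refine ⟨(h1.add h2).sub hXY.integrable_TrRe, ?_⟩
  rw [integral_sub (h1.fun_add h2) hXY.integrable_TrRe, integral_add h1 h2, integral_const_mul,
    integral_const_mul, hX.integral_TrRe, hY.integral_TrRe, hXY.integral_TrRe]

/-- The gap in the convexity inequality for `H_Φ` is the Jensen gap of `traceGap`. -/
theorem entropy_convexity_iff_jensen {Ω : Type*} [MeasurableSpace Ω] {μ : Measure Ω} {d : ℕ}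
    (hd : 0 < d) {Φ : ℝ → ℝ} {X Y : Ω → Mat d} {t : ℝ}
    (hX : MatIntegrable μ X) (hY : MatIntegrable μ Y)
    (hΦX : MatIntegrable μ fun ω => matFun Φ (X ω))
    (hΦY : MatIntegrable μ fun ω => matFun Φ (Y ω))
    (hΦXY : MatIntegrable μ fun ω => matFun Φ (t • X ω + (1 - t) • Y ω)) :
    ntr (expMat μ (fun ω => matFun Φ (t • X ω + (1 - t) • Y ω))
            - matFun Φ (expMat μ (fun ω => t • X ω + (1 - t) • Y ω)))
        ≤ t * ntr (expMat μ (fun ω => matFun Φ (X ω)) - matFun Φ (expMat μ X))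
          + (1 - t) * ntr (expMat μ (fun ω => matFun Φ (Y ω)) - matFun Φ (expMat μ Y))
      ↔ traceGap Φ t (expMat μ X, expMat μ Y) ≤ ∫ ω, traceGap Φ t (X ω, Y ω) ∂μ := by
  have hd' : (0 : ℝ) < d := Nat.cast_pos.mpr hd
  rw [(integral_traceGap hΦX hΦY hΦXY).2, expMat_real_combination hX hY, traceGap_eq]
  simp only [ntr_eq_TrRe_div, TrRe_sub]
  rw [← mul_div_assoc, ← mul_div_assoc, ← add_div, div_le_div_iff_of_pos_right hd']
  constructor <;> intro h <;> linarith

/-- A convex function on `[0, ∞)` whose gap along the segment from `(0, 0)` to `(1, 0)` is bounded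
by its chord has no jump at `0`. -/
theorem ConvexOn.continuousOn_Ici_of_gap_le {Φ : ℝ → ℝ} (hconv : ConvexOn ℝ (Set.Ici (0 : ℝ)) Φ)
    (hgap : ∀ t ∈ Set.Icc (0 : ℝ) 1, ∀ s ∈ Set.Icc (0 : ℝ) 1,
      t * Φ s + (1 - t) * Φ 0 - Φ (t * s) ≤ s * (t * Φ 1 + (1 - t) * Φ 0 - Φ t)) :
    ContinuousOn Φ (Set.Ici 0) := by
  intro x hx
  rcases (Set.mem_Ici.mp hx).eq_or_lt with rfl | hpos
  · obtain ⟨B, hB0, hB⟩ : ∃ B : ℝ, 0 ≤ B ∧ ∀ y ∈ Set.Icc (0 : ℝ) 1, -B ≤ Φ y := by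
      refine ⟨2 * |Φ 1| + |Φ 1| + |Φ 2|, by positivity, fun y hy => ?_⟩
      have h1 := hconv.2 (show y ∈ Set.Ici (0 : ℝ) from hy.1)
        (show 2 - y ∈ Set.Ici (0 : ℝ) from by simp only [Set.mem_Ici]; linarith [hy.2])
        (show (0 : ℝ) ≤ 1 / 2 by norm_num) (show (0 : ℝ) ≤ 1 / 2 by norm_num) (by norm_num)
      have h2 := hconv.2 (show (1 : ℝ) ∈ Set.Ici (0 : ℝ) by simp)
        (show (2 : ℝ) ∈ Set.Ici (0 : ℝ) by simp) hy.1 (sub_nonneg.mpr hy.2) (by ring)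
      simp only [smul_eq_mul] at h1 h2
      rw [show 1 / 2 * y + 1 / 2 * (2 - y) = 1 by ring] at h1
      rw [show y * 1 + (1 - y) * 2 = 2 - y by ring] at h2
      have h3 : y * Φ 1 ≤ |Φ 1| := by nlinarith [le_abs_self (Φ 1), abs_nonneg (Φ 1), hy.1, hy.2]
      have h4 : (1 - y) * Φ 2 ≤ |Φ 2| := by
        nlinarith [le_abs_self (Φ 2), abs_nonneg (Φ 2), hy.1, hy.2]
      linarith [neg_abs_le (Φ 1)]
    have hlow : ∀ y ∈ Set.Icc (0 : ℝ) 1,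
        Φ 0 - √y * (|Φ 1| + 2 * |Φ 0| + 2 * B) ≤ Φ y := by
      intro y hy
      have ht : √y ∈ Set.Icc (0 : ℝ) 1 := ⟨Real.sqrt_nonneg y, Real.sqrt_le_one.mpr hy.2⟩
      have h := hgap _ ht _ ht
      rw [Real.mul_self_sqrt hy.1] at h
      have hb := hB _ ht
      generalize √y = t at *
      have e1 : t * Φ 1 ≤ |Φ 1| := by nlinarith [le_abs_self (Φ 1), abs_nonneg (Φ 1), ht.1, ht.2]
      have e2 : (1 - t) * Φ 0 ≤ |Φ 0| := by
        nlinarith [le_abs_self (Φ 0), abs_nonneg (Φ 0), ht.1, ht.2]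
      have e3 : (t * Φ 1 + (1 - t) * Φ 0 - Φ t) + (Φ 0 - Φ t) ≤ |Φ 1| + 2 * |Φ 0| + 2 * B := by
        linarith [le_abs_self (Φ 0)]
      nlinarith [mul_le_mul_of_nonneg_left e3 ht.1]
    have hup : ∀ y ∈ Set.Icc (0 : ℝ) 1, Φ y ≤ (1 - y) * Φ 0 + y * Φ 1 := by
      intro y hy
      simpa using hconv.2 (show (0 : ℝ) ∈ Set.Ici (0 : ℝ) by simp)
        (show (1 : ℝ) ∈ Set.Ici (0 : ℝ) by simp) (sub_nonneg.mpr hy.2) hy.1 (by ring)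
    have hmem : ∀ᶠ y in nhdsWithin (0 : ℝ) (Set.Ici 0), y ∈ Set.Icc (0 : ℝ) 1 :=
      Icc_mem_nhdsGE one_pos
    have hl : Filter.Tendsto (fun y : ℝ => Φ 0 - √y * (|Φ 1| + 2 * |Φ 0| + 2 * B))
        (nhdsWithin 0 (Set.Ici 0)) (nhds (Φ 0)) := by
      have : Continuous fun y : ℝ => Φ 0 - √y * (|Φ 1| + 2 * |Φ 0| + 2 * B) := by fun_prop
      simpa using (this.tendsto 0).mono_left nhdsWithin_le_nhds
    have hu : Filter.Tendsto (fun y : ℝ => (1 - y) * Φ 0 + y * Φ 1)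
        (nhdsWithin 0 (Set.Ici 0)) (nhds (Φ 0)) := by
      have : Continuous fun y : ℝ => (1 - y) * Φ 0 + y * Φ 1 := by fun_prop
      simpa using (this.tendsto 0).mono_left nhdsWithin_le_nhds
    exact tendsto_of_tendsto_of_tendsto_of_le_of_le' hl hu (hmem.mono hlow) (hmem.mono hup)
  · have h := hconv.continuousOn_interior
    rw [interior_Ici] at h
    exact (h.continuousAt (Ioi_mem_nhds hpos)).continuousWithinAt

theorem continuousOn_of_convexOn_traceGap {d : ℕ} (hd : 0 < d) {Φ : ℝ → ℝ}
    (hconv : ConvexOn ℝ (Set.Ici (0 : ℝ)) Φ)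
    (h : ∀ t ∈ Set.Icc (0 : ℝ) 1, ConvexOn ℝ
      ({A : Mat d | A.PosSemidef} ×ˢ {A : Mat d | A.PosSemidef}) (traceGap Φ t)) :
    ContinuousOn Φ (Set.Ici 0) := by
  refine hconv.continuousOn_Ici_of_gap_le fun t ht s hs => ?_
  have hd' : (0 : ℝ) < d := Nat.cast_pos.mpr hd
  have hval : ∀ a b : ℝ, traceGap Φ t (a • (1 : Mat d), b • (1 : Mat d)) =
      d * (t * Φ a + (1 - t) * Φ b - Φ (t * a + (1 - t) * b)) := by
    intro a b
    rw [traceGap_eq]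
    simp only [smul_smul, ← add_smul, matFun_smul_one, TrRe_smul, TrRe_one]
    ring
  have hpos : ∀ a : ℝ, 0 ≤ a → (a • (1 : Mat d)).PosSemidef := fun a ha =>
    Matrix.PosSemidef.one.smul ha
  have key := (h t ht).2 (x := ((1 : ℝ) • (1 : Mat d), (0 : ℝ) • (1 : Mat d)))
    (y := ((0 : ℝ) • (1 : Mat d), (0 : ℝ) • (1 : Mat d)))
    ⟨hpos 1 zero_le_one, hpos 0 le_rfl⟩ ⟨hpos 0 le_rfl, hpos 0 le_rfl⟩
    hs.1 (sub_nonneg.mpr hs.2) (by ring)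
  simp only [Prod.smul_mk, Prod.mk_add_mk, smul_smul, ← add_smul, hval, smul_eq_mul, mul_one,
    mul_zero, add_zero] at key
  refine le_of_mul_le_mul_left ?_ hd'
  linarith

theorem entropyConvex_of_convexOn_traceGap {d : ℕ} (hd : 0 < d) {Φ : ℝ → ℝ}
    (hconv : ConvexOn ℝ (Set.Ici (0 : ℝ)) Φ)
    (h : ∀ t ∈ Set.Icc (0 : ℝ) 1, ConvexOn ℝ
      ({A : Mat d | A.PosSemidef} ×ˢ {A : Mat d | A.PosSemidef}) (traceGap Φ t)) :
    EntropyConvex d Φ := by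
  intro Ω _ μ _ X Y _ _ hXpos hYpos hX hY hΦX hΦY t ht hΦXY
  rw [entropy_convexity_iff_jensen hd hX hY hΦX hΦY hΦXY]
  have hJ := (h t ht).map_integral_le (μ := μ) (f := fun ω => (X ω, Y ω))
    (continuousOn_traceGap (continuousOn_of_convexOn_traceGap hd hconv h) ht)
    (isClosed_posSemidef.prod isClosed_posSemidef)
    (Filter.Eventually.of_forall fun ω => ⟨hXpos ω, hYpos ω⟩)
    (hX.integrable.prodMk hY.integrable) (integral_traceGap hΦX hΦY hΦXY).1
  rwa [integral_pair hX.integrable hY.integrable, hX.integral_eq_expMat,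
    hY.integral_eq_expMat] at hJ

/-- The law on `Bool` giving mass `s` to `true` and `1 - s` to `false`. -/
def twoPointMeasure (s : ℝ) : Measure Bool :=
  ENNReal.ofReal s • Measure.dirac true + ENNReal.ofReal (1 - s) • Measure.dirac false

theorem isProbabilityMeasure_twoPointMeasure {s : ℝ} (hs : s ∈ Set.Icc (0 : ℝ) 1) :
    IsProbabilityMeasure (twoPointMeasure s) := by
  constructor
  simp [twoPointMeasure, ← ENNReal.ofReal_add hs.1 (sub_nonneg.mpr hs.2)]

theorem integral_twoPointMeasure {E : Type*} [NormedAddCommGroup E] [NormedSpace ℝ E]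
    [CompleteSpace E] {s : ℝ} (hs : s ∈ Set.Icc (0 : ℝ) 1) (f : Bool → E) :
    ∫ ω, f ω ∂twoPointMeasure s = s • f true + (1 - s) • f false := by
  have := isProbabilityMeasure_twoPointMeasure hs
  have hint : Integrable f (twoPointMeasure s) := .of_finite
  rw [twoPointMeasure] at hint ⊢
  rw [integral_add_measure hint.left_of_add_measure hint.right_of_add_measure,
    integral_smul_measure, integral_smul_measure, integral_dirac, integral_dirac,
    ENNReal.toReal_ofReal hs.1, ENNReal.toReal_ofReal (sub_nonneg.mpr hs.2)]

theorem convexOn_traceGap_of_entropyConvex {d : ℕ} (hd : 0 < d) {Φ : ℝ → ℝ}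
    (h : EntropyConvex d Φ) {t : ℝ} (ht : t ∈ Set.Icc (0 : ℝ) 1) :
    ConvexOn ℝ ({A : Mat d | A.PosSemidef} ×ˢ {A : Mat d | A.PosSemidef}) (traceGap Φ t) := by
  refine ⟨fun p hp q hq a b ha hb _ => ⟨posSemidef_real_combination hp.1 hq.1 ha hb,
    posSemidef_real_combination hp.2 hq.2 ha hb⟩, fun p hp q hq a b ha hb hab => ?_⟩
  obtain rfl : b = 1 - a := by linarith
  have hs : a ∈ Set.Icc (0 : ℝ) 1 := ⟨ha, sub_nonneg.mp hb⟩
  have := isProbabilityMeasure_twoPointMeasure hs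
  have hint : ∀ Z : Bool → Mat d, MatIntegrable (twoPointMeasure a) Z := fun Z i j => .of_finite
  have hexp : ∀ Z : Bool → Mat d,
      expMat (twoPointMeasure a) Z = a • Z true + (1 - a) • Z false := fun Z => by
    rw [← (hint Z).integral_eq_expMat, integral_twoPointMeasure hs]
  let P : Bool → Mat d × Mat d := fun ω => bif ω then p else q
  have hP : ∀ ω, P ω ∈ {A : Mat d | A.PosSemidef} ×ˢ {A : Mat d | A.PosSemidef} := by
    rintro (_ | _)
    exacts [hq, hp]
  have key := h Bool ⊤ (twoPointMeasure a) this (fun ω => (P ω).1) (fun ω => (P ω).2)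
    (fun _ _ => measurable_from_top) (fun _ _ => measurable_from_top)
    (fun ω => (hP ω).1) (fun ω => (hP ω).2) (hint _) (hint _) (hint _) (hint _) t ht (hint _)
  rw [entropy_convexity_iff_jensen hd (hint _) (hint _) (hint _) (hint _) (hint _), hexp, hexp,
    integral_twoPointMeasure hs] at key
  exact key

end TraceGap

/-- **Equivalence of the joint trace convexity (f) and convexity of the matrix `Φ`-entropy
functional (h)** (part of Theorem 3.4). -/
theorem trace_gap_convex_iff_entropy_convex (d : ℕ) (Φ : ℝ → ℝ)
    (hconv : ConvexOn ℝ (Set.Ici (0 : ℝ)) Φ) :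
    (∀ t : ℝ, t ∈ Set.Icc (0 : ℝ) 1 →
      ∀ u₁ u₂ v₁ v₂ : Mat d, u₁.PosSemidef → u₂.PosSemidef →
        v₁.PosSemidef → v₂.PosSemidef →
        ∀ s : ℝ, s ∈ Set.Icc (0 : ℝ) 1 →
          TrRe (t • matFun Φ (s • u₁ + (1 - s) • u₂)
              + (1 - t) • matFun Φ (s • v₁ + (1 - s) • v₂)
              - matFun Φ (t • (s • u₁ + (1 - s) • u₂) + (1 - t) • (s • v₁ + (1 - s) • v₂)))
            ≤ s * TrRe (t • matFun Φ u₁ + (1 - t) • matFun Φ v₁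
                  - matFun Φ (t • u₁ + (1 - t) • v₁))
              + (1 - s) * TrRe (t • matFun Φ u₂ + (1 - t) • matFun Φ v₂
                  - matFun Φ (t • u₂ + (1 - t) • v₂)))
      ↔ EntropyConvex d Φ := by
  rcases Nat.eq_zero_or_pos d with rfl | hd
  · simp [EntropyConvex, TrRe, ntr]
  constructor
  · intro h
    refine entropyConvex_of_convexOn_traceGap hd hconv fun t ht => ?_
    refine ⟨fun p hp q hq a b ha hb _ => ⟨posSemidef_real_combination hp.1 hq.1 ha hb,
      posSemidef_real_combination hp.2 hq.2 ha hb⟩, fun p hp q hq a b ha hb hab => ?_⟩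
    obtain rfl : b = 1 - a := by linarith
    exact h t ht p.1 q.1 p.2 q.2 hp.1 hq.1 hp.2 hq.2 a ⟨ha, sub_nonneg.mp hb⟩
  · intro h t ht u₁ u₂ v₁ v₂ hu₁ hu₂ hv₁ hv₂ s hs
    exact (convexOn_traceGap_of_entropyConvex hd h ht).2 (x := (u₁, v₁)) (y := (u₂, v₂))
      ⟨hu₁, hv₁⟩ ⟨hu₂, hv₂⟩ hs.1 (sub_nonneg.mpr hs.2) (by ring)
end
end
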